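/- arXiv:1909.13388 — 2 statements merged into one kernel-verified Lean document; each statement's English description precedes it below -/
import Mathlib

section
/- Let n ≥ 1, 0 ≤ m ≤ n, and k ≥ 1. Then the sum, over all ordered pairs (s, π) where s is an n-cycle on [n] and π is a permutation of [n] with exactly k cycles that separates [m], of the number of exceedances of the pair (s, π), equals (n−k)·(n−1)!·C_m(n, k) − Σ_{j≥1} [ m·binom(k+2j−m, 2j) + binom(k+2j−m, 2j+1) ] · (n−1)! · C_m(n, k+2j). -/
open Equiv Finset

noncomputable section

/-- The number of cycles of a permutation of `Fin n`, counting fixed points as cycles. -/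
def cycleCount {n : ℕ} (σ : Equiv.Perm (Fin n)) : ℕ :=
  σ.cycleType.card + (Finset.univ.filter fun x => σ x = x).card

/-- A permutation of `Fin n` consisting of a single cycle of length `n`
(equivalently, having exactly one cycle, fixed points counting as cycles). -/
def IsFullCycle {n : ℕ} (σ : Equiv.Perm (Fin n)) : Prop :=
  cycleCount σ = 1

/-- `σ` separates the first `m` elements (`1, …, m`, i.e. indices `0, …, m-1`):
they lie in pairwise distinct cycles of `σ`. -/
def Separates {n : ℕ} (m : ℕ) (σ : Equiv.Perm (Fin n)) : Prop :=
  ∀ i j : Fin n, (i : ℕ) < m → (j : ℕ) < m → i ≠ j → ¬ σ.SameCycle i j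

/-- `C_m(N, k)`: the number of permutations of `[N]` with exactly `k` cycles
that separate the first `m` elements. -/
def sepCount (N m k : ℕ) : ℕ :=
  Nat.card {σ : Equiv.Perm (Fin N) // cycleCount σ = k ∧ Separates m σ}

/-- `C(N, k)`: the signless Stirling number of the first kind, i.e. the number of
permutations of `[N]` with exactly `k` cycles (fixed points counting as cycles). -/
def stirlingCycle (N k : ℕ) : ℕ :=
  Nat.card {σ : Equiv.Perm (Fin N) // cycleCount σ = k}

/-- The number of exceedances of the pair `(s, π)`, where the linear order `<_s` lists the
elements of `Fin n` in the order `0, s 0, s² 0, …, s^(n-1) 0` (`0` playing the role of the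
element `1` of `[n]`): an exceedance is an `x` with `x <_s π x`, i.e. `x` occurs at an
earlier position `a` than the position `b` of `π x`. -/
def exceedCount {n : ℕ} [NeZero n] (s π : Equiv.Perm (Fin n)) : ℕ :=
  Nat.card {x : Fin n // ∃ a b : ℕ, a < b ∧ b < n ∧ (s ^ a) 0 = x ∧ (s ^ b) 0 = π x}


open Polynomial

section generic

theorem sc_map {α β : Type} [Finite α] {π : Perm α} {σ : Perm β} (f : α → β)
    (h : ∀ x, σ.SameCycle (f x) (f (π x))) {x y : α} (hxy : π.SameCycle x y) :
    σ.SameCycle (f x) (f y) := by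
  obtain ⟨i, rfl⟩ := hxy.exists_nat_pow_eq
  induction i with
  | zero => exact Perm.SameCycle.refl _ _
  | succ i ih =>
    rw [pow_succ', Perm.mul_apply]
    exact (ih (Perm.sameCycle_pow_right.2 (Perm.SameCycle.refl _ _))).trans (h _)

def cyc {α : Type} (π : Perm α) : ℕ := Nat.card (Quotient (Perm.SameCycle.setoid π))

def sepP {α : Type} (S : Set α) (π : Perm α) : Prop :=
  ∀ i ∈ S, ∀ j ∈ S, i ≠ j → ¬ π.SameCycle i j

theorem cyc_eq_of {α β : Type} {π : Perm α} {σ : Perm β} (f : α → β)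
    (h : ∀ x y, π.SameCycle x y ↔ σ.SameCycle (f x) (f y))
    (hs : ∀ z, ∃ x, σ.SameCycle (f x) z) : cyc π = cyc σ := by
  refine Nat.card_congr (Equiv.ofBijective
    (Quotient.map f (fun x y hxy => (h x y).1 hxy)) ⟨?_, ?_⟩)
  · intro a b
    induction a using Quotient.inductionOn
    induction b using Quotient.inductionOn
    intro hab
    exact Quotient.sound ((h _ _).2 (Quotient.exact hab))
  · intro b
    induction b using Quotient.inductionOn with
    | h z =>
    obtain ⟨x, hx⟩ := hs z
    exact ⟨Quotient.mk _ x, Quotient.sound hx⟩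

theorem sc_permCongr {α β : Type} [Finite α] (e : α ≃ β) (π : Perm α) (x y : α) :
    π.SameCycle x y ↔ (e.permCongr π).SameCycle (e x) (e y) := by
  have : Finite β := Finite.of_equiv α e
  constructor
  · intro h
    refine sc_map e (fun x => ?_) h
    exact ⟨1, by simp⟩
  · intro h
    have := sc_map (σ := π) e.symm (fun x => ⟨1, by simp⟩) h
    simpa using this

theorem cyc_permCongr {α β : Type} [Finite α] (e : α ≃ β) (π : Perm α) :
    cyc (e.permCongr π) = cyc π :=
  (cyc_eq_of e (sc_permCongr e π) (fun z => ⟨e.symm z, by rw [apply_symm_apply]⟩)).symm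

theorem sepP_permCongr {α β : Type} [Finite α] (e : α ≃ β) (π : Perm α) (S : Set β) :
    sepP S (e.permCongr π) ↔ sepP (e ⁻¹' S) π := by
  constructor
  · intro h i hi j hj hij hc
    exact h _ hi _ hj (fun h => hij (e.injective h)) ((sc_permCongr e π i j).1 hc)
  · intro h i hi j hj hij hc
    refine h (e.symm i) (by simpa using hi) (e.symm j) (by simpa using hj)
      (fun h => hij (e.symm.injective h)) ((sc_permCongr e π _ _).2 (by simpa using hc))

theorem sc_option {β : Type} [Finite β] [DecidableEq β] (σ : Perm β) (a : Option β) (b c : β) :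
    σ.SameCycle b c ↔ (swap none a * optionCongr σ).SameCycle (some b) (some c) := by
  cases a with
  | none =>
    constructor
    · exact sc_map _ (fun x => ⟨1, by simp⟩)
    · intro h
      exact sc_map (σ := σ) (fun x : Option β => x.getD b) (fun x => by
        cases x with
        | none => exact Perm.SameCycle.refl _ _
        | some x => exact ⟨1, by simp⟩) h
  | some a =>
    constructor
    · refine sc_map _ (fun x => ?_)
      by_cases hx : σ x = a
      · refine ⟨2, ?_⟩
        rw [zpow_ofNat, pow_two]
        simp [hx]
      · refine ⟨1, ?_⟩
        simp only [zpow_one, Perm.mul_apply, optionCongr_apply, Option.map_some]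
        exact swap_apply_of_ne_of_ne (by simp) (by simpa using hx)
    · intro h
      refine sc_map (σ := σ) (fun x : Option β => x.getD a) (fun x => ?_) h
      cases x with
      | none =>
        refine ⟨0, ?_⟩
        simp
      | some x =>
        by_cases hx : σ x = a
        · refine ⟨1, ?_⟩
          simp [hx]
        · have : (swap none (some a) * optionCongr σ) (some x) = some (σ x) := by
            simp only [Perm.mul_apply, optionCongr_apply, Option.map_some]
            exact swap_apply_of_ne_of_ne (by simp) (by simpa using hx)
          rw [this]
          exact ⟨1, by simp⟩

theorem cyc_option_some {β : Type} [Finite β] [DecidableEq β] (σ : Perm β) (a : β) :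
    cyc (swap none (some a) * optionCongr σ) = cyc σ := by
  refine (cyc_eq_of some (sc_option σ (some a)) (fun z => ?_)).symm
  cases z with
  | none => exact ⟨a, Perm.SameCycle.symm ⟨1, by simp⟩⟩
  | some z => exact ⟨z, Perm.SameCycle.refl _ _⟩

theorem not_sc_option_none {β : Type} [Finite β] [DecidableEq β] (σ : Perm β) (b : β) :
    ¬ (swap none none * optionCongr σ).SameCycle none (some b) := by
  intro h
  obtain ⟨i, hi⟩ := h.exists_nat_pow_eq
  have : ∀ i : ℕ, ((swap none none * optionCongr σ : Perm (Option β)) ^ i) none = none := by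
    intro i
    exact Perm.pow_apply_eq_self_of_apply_eq_self (by simp) i
  rw [this] at hi
  cases hi

theorem cyc_option_none {β : Type} [Finite β] [DecidableEq β] (σ : Perm β) :
    cyc (swap none none * optionCongr σ) = cyc σ + 1 := by
  rw [cyc, cyc, ← Finite.card_option]
  symm
  refine Nat.card_congr (Equiv.ofBijective
    (fun q : Option (Quotient (Perm.SameCycle.setoid σ)) => q.elim (Quotient.mk _ none)
      (Quotient.map some (fun x y hxy => (sc_option σ none x y).1 hxy))) ⟨?_, ?_⟩)
  · intro p q
    cases p with
    | none =>
      cases q with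
      | none => simp
      | some q =>
        induction q using Quotient.inductionOn
        intro h
        exact absurd (Quotient.exact h) (not_sc_option_none _ _)
    | some p =>
      induction p using Quotient.inductionOn
      cases q with
      | none =>
        intro h
        exact absurd (Quotient.exact h.symm) (not_sc_option_none _ _)
      | some q =>
        induction q using Quotient.inductionOn
        intro h
        exact congrArg some (Quotient.sound ((sc_option σ none _ _).2 (Quotient.exact h)))
  · intro z
    induction z using Quotient.inductionOn with
    | h z =>
    cases z with
    | none => exact ⟨none, rfl⟩
    | some z => exact ⟨some (Quotient.mk _ z), rfl⟩

def decSepP {α : Type} (S : Set α) (π : Perm α) : Decidable (sepP S π) :=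
  Classical.propDecidable _

attribute [local instance] decSepP

def G (α : Type) [Fintype α] [DecidableEq α] (S : Set α) : ℤ[X] :=
  ∑ π : Perm α, if sepP S π then X ^ cyc π else 0

def Gf (α : Type) [Fintype α] [DecidableEq α] (S : Set α) (a : α) : ℤ[X] :=
  ∑ π : Perm α, if sepP S π ∧ π a = a then X ^ cyc π else 0

theorem G_congr {α β : Type} [Fintype α] [DecidableEq α] [Fintype β] [DecidableEq β]
    (e : α ≃ β) (S : Set β) : G β S = G α (e ⁻¹' S) := by
  unfold G
  rw [← Equiv.sum_comp e.permCongr]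
  refine Finset.sum_congr rfl fun π _ => ?_
  rw [cyc_permCongr]
  exact if_congr (sepP_permCongr e π S) rfl rfl

theorem Gf_congr {α β : Type} [Fintype α] [DecidableEq α] [Fintype β] [DecidableEq β]
    (e : α ≃ β) (S : Set β) (a : α) : Gf β S (e a) = Gf α (e ⁻¹' S) a := by
  unfold Gf
  rw [← Equiv.sum_comp e.permCongr]
  refine Finset.sum_congr rfl fun π _ => ?_
  rw [cyc_permCongr]
  refine if_congr (and_congr (sepP_permCongr e π S) ?_) rfl rfl
  simp

theorem sepP_option {β : Type} [Finite β] [DecidableEq β] (σ : Perm β) (a : Option β)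
    (S : Set (Option β)) (h : none ∉ S ∨ a = none) :
    sepP S (swap none a * optionCongr σ) ↔ sepP (some ⁻¹' S) σ := by
  constructor
  · intro hs i hi j hj hij hc
    exact hs _ hi _ hj (by simpa using hij) ((sc_option σ a i j).1 hc)
  · intro hs i hi j hj hij hc
    cases i with
    | none =>
      cases j with
      | none => exact hij rfl
      | some j =>
        rcases h with h | rfl
        · exact h hi
        · exact not_sc_option_none _ _ hc
    | some i =>
      cases j with
      | none =>
        rcases h with h | rfl
        · exact h hj
        · exact not_sc_option_none _ _ hc.symm
      | some j =>
        exact hs i hi j hj (by simpa using hij) ((sc_option σ a i j).2 hc)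

theorem G_option {β : Type} [Fintype β] [DecidableEq β] (S : Set (Option β)) (h : none ∉ S) :
    G (Option β) S = (X + (Fintype.card β : ℤ[X])) * G β (some ⁻¹' S) := by
  unfold G
  rw [← Equiv.sum_comp Perm.decomposeOption.symm, Fintype.sum_prod_type]
  have key : ∀ (a : Option β) (σ : Perm β),
      (if sepP S (Perm.decomposeOption.symm (a, σ)) then
        (X : ℤ[X]) ^ cyc (Perm.decomposeOption.symm (a, σ)) else 0) =
      if sepP (some ⁻¹' S) σ then X ^ cyc (swap none a * optionCongr σ) else 0 := by
    intro a σ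
    rw [Perm.decomposeOption_symm_apply]
    exact if_congr (sepP_option _ _ _ (Or.inl h)) rfl rfl
  simp only [key]
  rw [Fintype.sum_option]
  simp only [cyc_option_some, cyc_option_none]
  simp only [sum_const, card_univ, nsmul_eq_mul]
  rw [add_mul]
  refine congrArg₂ (· + ·) ?_ rfl
  rw [Finset.mul_sum]
  refine Finset.sum_congr rfl fun π _ => ?_
  split_ifs <;> ring

theorem Gf_option {β : Type} [Fintype β] [DecidableEq β] (S : Set (Option β)) :
    Gf (Option β) S none = X * G β (some ⁻¹' S) := by
  unfold Gf G
  rw [← Equiv.sum_comp Perm.decomposeOption.symm, Fintype.sum_prod_type]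
  rw [Fintype.sum_option]
  have h0 : ∀ σ : Perm β, (if sepP S (Perm.decomposeOption.symm (none, σ)) ∧
        (Perm.decomposeOption.symm (none, σ)) none = none then
        (X : ℤ[X]) ^ cyc (Perm.decomposeOption.symm (none, σ)) else 0) =
      X * if sepP (some ⁻¹' S) σ then X ^ cyc σ else 0 := by
    intro σ
    rw [Perm.decomposeOption_symm_apply]
    dsimp only
    rw [cyc_option_none, mul_ite, mul_zero, pow_succ']
    refine if_congr ?_ rfl rfl
    rw [sepP_option _ none _ (Or.inr rfl)]
    simp
  have h1 : ∀ (a : β) (σ : Perm β), (if sepP S (Perm.decomposeOption.symm (some a, σ)) ∧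
        (Perm.decomposeOption.symm (some a, σ)) none = none then
        (X : ℤ[X]) ^ cyc (Perm.decomposeOption.symm (some a, σ)) else 0) = 0 := by
    intro a σ
    rw [if_neg]
    rw [Perm.decomposeOption_symm_apply]
    simp
  simp only [h0, h1]
  rw [Finset.mul_sum]
  simp only [sum_const_zero, add_zero]

theorem G_univ {α : Type} [Fintype α] [DecidableEq α] :
    G α Set.univ = X ^ Fintype.card α := by
  unfold G
  have h1 : ∀ π : Perm α, sepP Set.univ π ↔ π = 1 := by
    intro π
    constructor
    · intro h
      ext x
      by_contra hx
      exact h x trivial (π x) trivial (fun h => hx h.symm) ⟨1, by simp⟩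
    · rintro rfl i _ j _ hij hc
      simp at hc
      exact hij hc
  simp only [h1]
  rw [Finset.sum_ite_eq']
  simp only [mem_univ, if_true]
  congr 1
  rw [cyc, ← Nat.card_eq_fintype_card]
  refine (Nat.card_congr (Equiv.ofBijective (Quotient.mk _) ⟨?_, Quotient.mk_surjective⟩)).symm
  intro x y hxy
  have := Quotient.exact hxy
  change Perm.SameCycle 1 x y at this
  simpa using this

def P (m n : ℕ) : ℤ[X] := ∏ i ∈ Finset.Ico m n, (X + (i : ℤ[X]))

theorem option_equiv {α : Type} [DecidableEq α] (a : α) :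
    ∃ e : Option {b : α // b ≠ a} ≃ α, e none = a ∧ ∀ b, e (some b) = b.1 :=
  ⟨Equiv.optionSubtypeNe a, by simp, by simp⟩

theorem G_formula (N : ℕ) : ∀ (α : Type) [Fintype α] [DecidableEq α] (S : Set α),
    Fintype.card α = N → G α S = X ^ (Nat.card S) * P (Nat.card S) N := by
  induction N with
  | zero =>
    intro α _ _ S h
    have : IsEmpty α := Fintype.card_eq_zero_iff.1 h
    rw [Set.eq_univ_of_forall (s := S) (fun x => isEmptyElim x), G_univ]
    simp [P, h]
  | succ N ih =>
    intro α _ _ S h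
    by_cases hS : S = Set.univ
    · rw [hS, G_univ]
      simp [P, h]
    · obtain ⟨a, ha⟩ := (Set.ne_univ_iff_exists_notMem S).1 hS
      obtain ⟨e, he0, he1⟩ := option_equiv a
      have hc : Fintype.card {b : α // b ≠ a} = N := by
        have := Fintype.card_congr e
        rw [Fintype.card_option] at this
        omega
      have hSc : Nat.card (some ⁻¹' (e ⁻¹' S)) = Nat.card S := by
        refine Nat.card_congr (Equiv.ofBijective (fun x => ⟨e (some x.1), x.2⟩) ⟨?_, ?_⟩)
        · rintro ⟨x, hx⟩ ⟨y, hy⟩ hxy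
          simpa using hxy
        · rintro ⟨y, hy⟩
          have hya : y ≠ a := fun h => ha (h ▸ hy)
          exact ⟨⟨⟨y, hya⟩, by simpa [he1] using hy⟩, by simp [he1]⟩
      rw [G_congr e, G_option _ (by simpa [he0] using ha), ih _ _ hc, hc, hSc]
      have hle : Nat.card S ≤ N := by
        rw [← hSc, ← hc, ← Nat.card_eq_fintype_card]
        exact Finite.card_subtype_le _
      rw [P, P, Finset.prod_Ico_succ_top hle]
      ring

theorem Gf_formula {α : Type} [Fintype α] [DecidableEq α] (S : Set α) (a : α) :
    Gf α S a = X * (X ^ (Nat.card ↥(S \ {a})) * P (Nat.card ↥(S \ {a})) (Fintype.card α - 1)) := by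
  obtain ⟨e, he0, he1⟩ := option_equiv a
  have hc : Fintype.card {b : α // b ≠ a} = Fintype.card α - 1 := by
    have := Fintype.card_congr e
    rw [Fintype.card_option] at this
    omega
  have hSc : Nat.card (some ⁻¹' (e ⁻¹' S)) = Nat.card ↥(S \ {a}) := by
    refine Nat.card_congr (Equiv.ofBijective (fun x => ⟨e (some x.1), x.2, ?_⟩) ⟨?_, ?_⟩)
    · have := x.1.2
      simpa [he1] using this
    · rintro ⟨x, hx⟩ ⟨y, hy⟩ hxy
      simpa [he1, Subtype.ext_iff] using hxy
    · rintro ⟨y, hy, hya⟩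
      exact ⟨⟨⟨y, hya⟩, by simpa [he1] using hy⟩, by simp [he1]⟩
  have := Gf_congr e S none
  rw [he0] at this
  rw [this, Gf_option, G_formula _ _ _ hc, hSc]

theorem cyc_eq_cycleCount {n : ℕ} (π : Perm (Fin n)) : cycleCount π = cyc π := by
  classical
  have h1 : π.cycleType.card = π.cycleFactorsFinset.card := by
    simp [Perm.cycleType]
  rw [cycleCount, h1, cyc, ← Fintype.card_coe, ← Fintype.card_subtype,
    ← Fintype.card_sum, ← Nat.card_eq_fintype_card]
  symm
  have hw : ∀ x y, π.SameCycle x y → π x = x → x = y := by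
    intro x y h hx
    obtain ⟨i, hi⟩ := h.exists_nat_pow_eq
    rw [Perm.pow_apply_eq_self_of_apply_eq_self hx] at hi
    exact hi
  let f : Fin n → {x // x ∈ π.cycleFactorsFinset} ⊕ {x // π x = x} := fun x =>
    if h : π x = x then Sum.inr ⟨x, h⟩
    else Sum.inl ⟨π.cycleOf x, Perm.cycleOf_mem_cycleFactorsFinset_iff.2
      (by simpa using h)⟩
  have hf : ∀ x y, π.SameCycle x y ↔ f x = f y := by
    intro x y
    by_cases hx : π x = x
    · by_cases hy : π y = y
      · simp only [f, hx, hy, dif_pos]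
        constructor
        · intro h
          have := hw _ _ h hx
          simp [this]
        · intro h
          simp at h
          rw [h]
      · simp only [f, hx, hy, dif_pos]
        constructor
        · intro h
          have := hw _ _ h hx
          exact absurd (this ▸ hx) hy
        · intro h
          simp at h
    · by_cases hy : π y = y
      · simp only [f, hx, hy, dif_pos]
        constructor
        · intro h
          have := hw _ _ h.symm hy
          exact absurd (this ▸ hy) hx
        · intro h
          simp at h
      · simp only [f, hx, hy, dif_neg, not_false_iff]
        constructor
        · intro h
          simp [h.cycleOf_eq]
        · intro h
          simp only [Sum.inl.injEq, Subtype.mk.injEq] at h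
          have hx' : x ∈ (π.cycleOf x).support := by
            rw [Perm.mem_support_cycleOf_iff]
            exact ⟨Perm.SameCycle.refl _ _, by simpa using hx⟩
          rw [h, Perm.mem_support_cycleOf_iff] at hx'
          exact hx'.1.symm
  refine Nat.card_congr (Equiv.ofBijective (Quotient.lift f (fun x y h => (hf x y).1 h)) ⟨?_, ?_⟩)
  · intro p q
    induction p using Quotient.inductionOn
    induction q using Quotient.inductionOn
    intro h
    exact Quotient.sound ((hf _ _).2 h)
  · rintro (⟨c, hc⟩ | ⟨x, hx⟩)
    · obtain ⟨x, hx⟩ := (Perm.mem_cycleFactorsFinset_iff.1 hc).1.nonempty_support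
      have hcx := Perm.cycle_is_cycleOf hx hc
      have hx' : ¬ π x = x := by
        have := Perm.mem_cycleFactorsFinset_support_le hc hx
        simpa using this
      refine ⟨Quotient.mk _ x, ?_⟩
      change f x = _
      simp [f, hx', hcx]
    · refine ⟨Quotient.mk _ x, ?_⟩
      change f x = _
      simp [f, hx]

end generic

section exceed

variable {n : ℕ}

def exR [NeZero n] (s : Perm (Fin n)) (x y : Fin n) : Prop :=
  ∃ a b : ℕ, a < b ∧ b < n ∧ (s ^ a) 0 = x ∧ (s ^ b) 0 = y

def decExR [NeZero n] (s : Perm (Fin n)) (x y : Fin n) : Decidable (exR s x y) :=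
  Classical.propDecidable _

def decFull (s : Perm (Fin n)) : Decidable (IsFullCycle s) :=
  Classical.propDecidable _

attribute [local instance] decExR decFull

theorem full_isCycleOn {s : Perm (Fin n)} (h : IsFullCycle s) :
    s.IsCycleOn ((Finset.univ : Finset (Fin n)) : Set (Fin n)) := by
  rw [IsFullCycle, cyc_eq_cycleCount, cyc, Nat.card_eq_one_iff_unique] at h
  refine ⟨?_, ?_⟩
  · simpa using s.bijective
  · intro x _ y _
    have := h.1
    exact Quotient.exact (Subsingleton.elim (Quotient.mk (Perm.SameCycle.setoid s) x)
      (Quotient.mk _ y))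

theorem full_pos [NeZero n] {s : Perm (Fin n)} (h : IsFullCycle s) (x : Fin n) :
    ∃ a < n, (s ^ a) 0 = x := by
  have := (full_isCycleOn h).exists_pow_eq (mem_univ 0) (mem_univ x)
  simpa using this

theorem full_inj [NeZero n] {s : Perm (Fin n)} (h : IsFullCycle s) {a b : ℕ} (ha : a < n)
    (hb : b < n) (hab : (s ^ a) 0 = (s ^ b) 0) : a = b := by
  rw [(full_isCycleOn h).pow_apply_eq_pow_apply (mem_univ 0)] at hab
  simp only [card_univ, Fintype.card_fin] at hab
  exact Nat.ModEq.eq_of_lt_of_lt hab ha hb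

theorem exR_iff_not [NeZero n] {s : Perm (Fin n)} (h : IsFullCycle s) {x y : Fin n} (hxy : x ≠ y) :
    exR s x y ↔ ¬ exR s y x := by
  constructor
  · rintro ⟨a, b, hab, hb, hx, hy⟩ ⟨c, d, hcd, hd, hy', hx'⟩
    have h1 := full_inj h (hab.trans hb) hd (hx.trans hx'.symm)
    have h2 := full_inj h hb (hcd.trans hd) (hy.trans hy'.symm)
    omega
  · intro hn
    obtain ⟨a, ha, hx⟩ := full_pos h x
    obtain ⟨b, hb, hy⟩ := full_pos h y
    rcases lt_trichotomy a b with hab | hab | hab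
    · exact ⟨a, b, hab, hb, hx, hy⟩
    · subst hab
      exact absurd (hx.symm.trans hy) hxy
    · exact absurd ⟨b, a, hab, ha, hy, hx⟩ hn

theorem not_exR_self [NeZero n] {s : Perm (Fin n)} (h : IsFullCycle s) (x : Fin n) :
    ¬ exR s x x := by
  rintro ⟨a, b, hab, hb, hx, hy⟩
  have := full_inj h (hab.trans hb) hb (hx.trans hy.symm)
  omega

theorem not_exR_zero [NeZero n] {s : Perm (Fin n)} (h : IsFullCycle s) (x : Fin n) :
    ¬ exR s x 0 := by
  rintro ⟨a, b, hab, hb, hx, hy⟩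
  have := full_inj (a := b) (b := 0) h hb (by omega) (by simpa using hy)
  omega

theorem permCongr_pow_apply {α : Type} (c s : Perm α) (a : ℕ) (x : α) :
    ((c.permCongr s) ^ a) (c x) = c ((s ^ a) x) := by
  induction a with
  | zero => simp
  | succ a ih => rw [pow_succ', pow_succ', Perm.mul_apply, ih]; simp

theorem exR_permCongr [NeZero n] (c s : Perm (Fin n)) (hc : c 0 = 0) (x y : Fin n) :
    exR (c.permCongr s) (c x) (c y) ↔ exR s x y := by
  have h : ∀ a : ℕ, ((c.permCongr s) ^ a) 0 = c ((s ^ a) 0) := by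
    intro a
    have := permCongr_pow_apply c s a 0
    rwa [hc] at this
  simp only [exR, h, c.injective.eq_iff]

def NN [NeZero n] (x y : Fin n) : ℤ :=
  ∑ s : Perm (Fin n), if IsFullCycle s ∧ exR s x y then 1 else 0

def FF (n : ℕ) : ℤ := ∑ s : Perm (Fin n), if IsFullCycle s then 1 else 0

theorem NN_add [NeZero n] {x y : Fin n} (hxy : x ≠ y) : NN x y + NN y x = FF n := by
  unfold NN FF
  rw [← Finset.sum_add_distrib]
  refine Finset.sum_congr rfl fun s _ => ?_
  by_cases h : IsFullCycle s
  · by_cases h2 : exR s y x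
    · have := (exR_iff_not h hxy).not.2 (not_not.2 h2)
      simp [h, h2, this]
    · have := (exR_iff_not h hxy).2 h2
      simp [h, h2, this]
  · simp [h]

theorem NN_zero [NeZero n] (x : Fin n) : NN x 0 = 0 := by
  unfold NN
  refine Finset.sum_eq_zero fun s _ => ?_
  rw [if_neg]
  rintro ⟨h, h2⟩
  exact not_exR_zero h _ h2

theorem NN_self [NeZero n] (x : Fin n) : NN x x = 0 := by
  unfold NN
  refine Finset.sum_eq_zero fun s _ => ?_
  rw [if_neg]
  rintro ⟨h, h2⟩
  exact not_exR_self h _ h2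

theorem NN_symm [NeZero n] {x y : Fin n} (hx : x ≠ 0) (hy : y ≠ 0) : NN x y = NN y x := by
  unfold NN
  rw [← Equiv.sum_comp (swap x y).permCongr]
  refine Finset.sum_congr rfl fun s _ => ?_
  refine if_congr (and_congr ?_ ?_) rfl rfl
  · rw [IsFullCycle, IsFullCycle, cyc_eq_cycleCount, cyc_eq_cycleCount, cyc_permCongr]
  · have := exR_permCongr (swap x y) s (swap_apply_of_ne_of_ne hx.symm hy.symm) y x
    rwa [swap_apply_left, swap_apply_right] at this

theorem NN_eq [NeZero n] (x y : Fin n) : 2 * NN x y = FF n *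
    ((1 - if x = y then 1 else 0) + ((if x = 0 then 1 else 0) - (if y = 0 then 1 else 0))) := by
  by_cases hxy : x = y
  · subst hxy
    rw [NN_self]; simp
  · have h1 := NN_add hxy
    by_cases hx : x = 0
    · subst hx
      rw [NN_zero, add_zero] at h1
      rw [h1]
      simp [hxy, Ne.symm hxy]
      ring
    · by_cases hy : y = 0
      · subst hy
        rw [NN_zero]
        simp [hx]
      · rw [NN_symm hy hx] at h1
        simp [hxy, hx, hy]
        linarith

theorem exceed_sum [NeZero n] (π : Perm (Fin n)) :
    2 * ∑ s : Perm (Fin n), (if IsFullCycle s then (exceedCount s π : ℤ) else 0) =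
      FF n * (n - ∑ x : Fin n, if π x = x then 1 else 0) := by
  have h1 : ∀ s : Perm (Fin n), (if IsFullCycle s then (exceedCount s π : ℤ) else 0) =
      ∑ x : Fin n, if IsFullCycle s ∧ exR s x (π x) then 1 else 0 := by
    intro s
    by_cases h : IsFullCycle s
    · simp only [h, true_and, if_true]
      change ((Nat.card {x : Fin n // exR s x (π x)} : ℕ) : ℤ) = _
      rw [Nat.card_eq_fintype_card, Fintype.card_subtype, Finset.card_filter]
      push_cast
      rfl
    · simp [h]
  simp only [h1]
  rw [Finset.sum_comm, Finset.mul_sum]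
  have h2 : ∀ x : Fin n, (2 * ∑ s : Perm (Fin n),
      if IsFullCycle s ∧ exR s x (π x) then (1 : ℤ) else 0) = _ := fun x => NN_eq x (π x)
  simp only [h2]
  rw [← Finset.mul_sum, Finset.sum_add_distrib, Finset.sum_sub_distrib, Finset.sum_sub_distrib,
    Equiv.sum_comp π (fun y => if y = 0 then (1 : ℤ) else 0)]
  simp [eq_comm]

end exceed

section poly

attribute [local instance] decSepP decFull

theorem G_coeff (n k : ℕ) (S : Set (Fin n)) :
    (G (Fin n) S).coeff k = ∑ π : Perm (Fin n), if cycleCount π = k ∧ sepP S π then 1 else 0 := by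
  unfold G
  rw [finsetSum_coeff]
  refine Finset.sum_congr rfl fun π _ => ?_
  rw [cyc_eq_cycleCount]
  by_cases h : sepP S π <;> simp [h, coeff_X_pow, eq_comm]

theorem Gf_coeff (n k : ℕ) (S : Set (Fin n)) (a : Fin n) :
    (Gf (Fin n) S a).coeff k =
      ∑ π : Perm (Fin n), if cycleCount π = k ∧ sepP S π then (if π a = a then 1 else 0) else 0 := by
  unfold Gf
  rw [finsetSum_coeff]
  refine Finset.sum_congr rfl fun π _ => ?_
  rw [cyc_eq_cycleCount]
  by_cases h : sepP S π <;> by_cases h2 : π a = a <;> simp [h, h2, coeff_X_pow, eq_comm]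

def SS (n m : ℕ) : Set (Fin n) := {i | (i : ℕ) < m}

theorem card_SS {n m : ℕ} (hm : m ≤ n) : Nat.card (SS n m) = m := by
  unfold SS
  rw [Nat.card_eq_fintype_card]
  simp [Fintype.card_subtype, hm, Fin.card_filter_val_lt]

theorem separates_iff {n m : ℕ} (π : Perm (Fin n)) : Separates m π ↔ sepP (SS n m) π := by
  unfold Separates sepP SS
  constructor
  · intro h i hi j hj
    exact h i j hi hj
  · intro h i j hi hj
    exact h i hi j hj

theorem sepCount_eq {n m k : ℕ} : (sepCount n m k : ℤ) = (G (Fin n) (SS n m)).coeff k := by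
  classical
  rw [G_coeff, sepCount, Nat.card_eq_fintype_card, Fintype.card_subtype, Finset.card_filter]
  push_cast
  refine Finset.sum_congr rfl fun π _ => ?_
  exact if_congr (and_congr Iff.rfl (separates_iff π)) rfl rfl

theorem G_SS {n m : ℕ} (hm : m ≤ n) : G (Fin n) (SS n m) = X ^ m * P m n := by
  rw [G_formula n _ _ (by simp), card_SS hm]

theorem FF_eq {n : ℕ} [NeZero n] : FF n = (n - 1).factorial := by
  have h : FF n = (G (Fin n) (SS n 0)).coeff 1 := by
    rw [G_coeff, FF]
    refine Finset.sum_congr rfl fun π _ => ?_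
    refine if_congr ?_ rfl rfl
    rw [IsFullCycle]
    simp [← separates_iff, Separates]
  rw [h, G_SS (Nat.zero_le _)]
  obtain ⟨N, rfl⟩ := Nat.exists_eq_succ_of_ne_zero (NeZero.ne n)
  rw [P, Finset.prod_eq_prod_Ico_succ_bot (by omega)]
  simp only [pow_zero, one_mul, Nat.cast_zero, add_zero, zero_add]
  rw [show (1 : ℕ) = 0 + 1 from rfl, coeff_X_mul, coeff_zero_eq_eval_zero, eval_prod]
  simp only [eval_add, eval_X, eval_natCast, zero_add, Nat.succ_eq_add_one,
    Nat.add_sub_cancel]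
  rw [← Finset.prod_range_add_one_eq_factorial, Finset.prod_Ico_eq_prod_range]
  push_cast
  refine Finset.prod_congr rfl fun i _ => ?_
  push_cast
  ring

theorem natDegree_P (m n : ℕ) : (P m n).natDegree ≤ n := by
  unfold P
  refine (natDegree_prod_le _ _).trans ?_
  refine (Finset.sum_le_card_nsmul _ _ 1 fun i _ => ?_).trans ?_
  · compute_degree
  · simp

theorem P_taylor_one {m n : ℕ} (h : m ≤ n) :
    (X + (m : ℤ[X])) * taylor 1 (P m n) = (X + (n : ℤ[X])) * P m n := by
  induction n, h using Nat.le_induction with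
  | base => simp [P]
  | succ n hn ih =>
    have : P m (n + 1) = P m n * (X + (n : ℤ[X])) := by
      rw [P, P, Finset.prod_Ico_succ_top hn]
    rw [this, taylor_mul, ← mul_assoc, ih]
    simp [taylor_apply]
    ring

theorem P_taylor_neg {m n : ℕ} (h : m ≤ n) :
    taylor (-1) (P m (n + 1)) = (X + (m : ℤ[X]) - 1) * P m n := by
  induction n, h using Nat.le_induction with
  | base =>
    simp [P, taylor_apply]
    ring
  | succ n hn ih =>
    have h1 : P m (n + 1) = P m n * (X + (n : ℤ[X])) := by
      rw [P, P, Finset.prod_Ico_succ_top hn]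
    have h2 : P m (n + 1 + 1) = P m (n + 1) * (X + ((n + 1 : ℕ) : ℤ[X])) := by
      rw [P, P, Finset.prod_Ico_succ_top (by omega)]
    rw [h2, taylor_mul, ih, h1]
    simp [taylor_apply]
    ring

theorem P_shift (m n : ℕ) : P m n = taylor (-1) (P (m + 1) (n + 1)) := by
  have : taylor (-1) (P (m + 1) (n + 1)) = taylorAlgHom (-1) (P (m + 1) (n + 1)) := rfl
  rw [this, P, P, map_prod, ← Finset.prod_Ico_add' _ m n 1]
  refine Finset.prod_congr rfl fun i _ => ?_
  simp [taylor_apply]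
  ring

def H (m n : ℕ) : ℤ[X] :=
  (m : ℤ[X]) * (taylor 1 (P m n) + taylor (-1) (P m n)) +
    X * (taylor 1 (P m n) - taylor (-1) (P m n)) - (n : ℤ[X]) * P m n

theorem Gf_sum {n m : ℕ} [NeZero n] (hm : m ≤ n) :
    ∑ a, Gf (Fin n) (SS n m) a = X ^ m * H m n := by
  have h1 : ∀ a : Fin n, Gf (Fin n) (SS n m) a =
      if (a : ℕ) < m then X ^ m * taylor (-1) (P m n) else X * (X ^ m * P m (n - 1)) := by
    intro a
    have hn : n - 1 + 1 = n := Nat.sub_add_cancel (NeZero.one_le)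
    rw [Gf_formula, Fintype.card_fin]
    split_ifs with h
    · have : Nat.card ↥(SS n m \ {a}) = m - 1 := by
        have h2 := Set.ncard_sdiff_singleton_of_mem (s := SS n m) (a := a) h
        rw [← Nat.card_coe_set_eq, ← Nat.card_coe_set_eq, card_SS hm] at h2
        exact h2
      rw [this, P_shift, hn, Nat.sub_add_cancel (by omega), ← mul_assoc, ← pow_succ',
        Nat.sub_add_cancel (by omega)]
    · have : SS n m \ {a} = SS n m := Set.sdiff_singleton_eq_self h
      rw [this, card_SS hm]
  simp only [h1]
  rw [Finset.sum_ite, Finset.sum_const, Finset.sum_const]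
  have hc : (Finset.univ.filter fun a : Fin n => (a : ℕ) < m).card = m := by
    simp [Fin.card_filter_val_lt, hm]
  have hc2 : (Finset.univ.filter fun a : Fin n => ¬ (a : ℕ) < m).card = n - m := by
    rw [Finset.filter_not, Finset.card_sdiff_of_subset (Finset.filter_subset _ _), hc]
    simp
  rw [hc, hc2, nsmul_eq_mul, nsmul_eq_mul, Nat.cast_sub hm]
  have key : ((n : ℤ[X]) - m) * P m (n - 1) = P m n - taylor (-1) (P m n) := by
    rcases hm.eq_or_lt with rfl | hlt
    · simp [P]
    · obtain ⟨N, rfl⟩ := Nat.exists_eq_succ_of_ne_zero (NeZero.ne n)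
      have hN : m ≤ N := by omega
      have h2 : P m (N + 1) = P m N * (X + (N : ℤ[X])) := by
        rw [P, P, Finset.prod_Ico_succ_top hN]
      rw [Nat.succ_eq_add_one, P_taylor_neg hN, h2, Nat.add_sub_cancel]
      push_cast
      ring
  have k2 := P_taylor_one hm
  unfold H
  linear_combination X ^ m * X * key - X ^ m * k2

theorem taylor_coeff_sum (Q : ℤ[X]) (r : ℤ) (d N : ℕ) (hQ : Q.natDegree < N) :
    (taylor r Q).coeff d = ∑ i ∈ Finset.range N, ((d + i).choose i : ℤ) * Q.coeff (d + i) * r ^ i := by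
  rw [taylor_coeff, eval_eq_sum_range' (n := N)]
  · refine Finset.sum_congr rfl fun i _ => ?_
    rw [hasseDeriv_coeff, add_comm i d, Nat.choose_symm_add]
  · exact lt_of_le_of_lt (natDegree_hasseDeriv_le _ _) (by omega)

theorem sum_range_even_odd (f : ℕ → ℤ) (N : ℕ) :
    ∑ i ∈ Finset.range (2 * N), f i = ∑ j ∈ Finset.range N, (f (2 * j) + f (2 * j + 1)) := by
  induction N with
  | zero => simp
  | succ N ih =>
    rw [Finset.sum_range_succ, ← ih, mul_add, mul_one, Finset.sum_range_succ,
      Finset.sum_range_succ, add_assoc]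

theorem taylor_even (Q : ℤ[X]) (d N : ℕ) (hQ : Q.natDegree < 2 * N) :
    (taylor 1 Q).coeff d + (taylor (-1) Q).coeff d =
      2 * ∑ j ∈ Finset.range N, ((d + 2 * j).choose (2 * j) : ℤ) * Q.coeff (d + 2 * j) := by
  rw [taylor_coeff_sum _ _ _ _ hQ, taylor_coeff_sum _ _ _ _ hQ, sum_range_even_odd,
    sum_range_even_odd, ← Finset.sum_add_distrib, Finset.mul_sum]
  refine Finset.sum_congr rfl fun j _ => ?_
  simp only [pow_succ, pow_mul]
  norm_num
  ring

theorem taylor_odd (Q : ℤ[X]) (d N : ℕ) (hQ : Q.natDegree < 2 * N) :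
    (X * (taylor 1 Q - taylor (-1) Q)).coeff d =
      2 * ∑ j ∈ Finset.range N, ((d + 2 * j).choose (2 * j + 1) : ℤ) * Q.coeff (d + 2 * j) := by
  cases d with
  | zero => simp
  | succ d =>
    rw [coeff_X_mul, coeff_sub]
    rw [taylor_coeff_sum _ _ _ _ hQ, taylor_coeff_sum _ _ _ _ hQ, sum_range_even_odd,
      sum_range_even_odd, ← Finset.sum_sub_distrib, Finset.mul_sum]
    refine Finset.sum_congr rfl fun j _ => ?_
    simp only [pow_succ, pow_mul]
    rw [show d + 1 + 2 * j = d + (2 * j + 1) by ring]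
    norm_num
    ring

theorem H_coeff (m n d : ℕ) : (H m n).coeff d =
    (2 * ((d + m : ℕ) : ℤ) - n) * (P m n).coeff d +
    2 * ∑ j ∈ Finset.Icc 1 n, ((m * Nat.choose (d + 2 * j) (2 * j) +
            Nat.choose (d + 2 * j) (2 * j + 1) : ℕ) : ℤ) * (P m n).coeff (d + 2 * j) := by
  have hQ : (P m n).natDegree < 2 * (n + 1) := lt_of_le_of_lt (natDegree_P m n) (by omega)
  unfold H
  rw [coeff_sub, coeff_add, coeff_natCast_mul, coeff_natCast_mul, coeff_add,
    taylor_even _ _ _ hQ, taylor_odd _ _ _ hQ]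
  have hI : Finset.Icc 1 n = Finset.Ico (0 + 1) (n + 1) := by ext; simp
  have hs : ∀ f : ℕ → ℤ, ∑ j ∈ Finset.range (n + 1), f j = f 0 + ∑ j ∈ Finset.Icc 1 n, f j := by
    intro f
    rw [hI, Finset.range_eq_Ico, Finset.sum_eq_sum_Ico_succ_bot (by omega)]
  rw [hs, hs]
  push_cast
  simp only [add_mul, Finset.sum_add_distrib, mul_assoc, ← Finset.mul_sum]
  simp
  ring

end poly

open scoped Classical in
/-- For `n ≥ 1`, `m ≤ n` and `k ≥ 1`, the sum over all pairs `(s, π)`,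
with `s` an `n`-cycle and `π` a permutation of `[n]` with `k` cycles separating `[m]`, of
the number of exceedances of `(s, π)` equals
`(n-k)(n-1)! C_m(n,k) - Σ_{j ≥ 1} [ m binom(k+2j-m, 2j) + binom(k+2j-m, 2j+1) ] (n-1)! C_m(n, k+2j)`
(the sum over `j ≥ 1` is finite since `C_m(n, k+2j) = 0` once `k + 2j > n`, so it may be
truncated at `j = n`). -/
theorem total_exceedances_recurrence (n m k : ℕ) [NeZero n] (hm : m ≤ n) (hk : 1 ≤ k) :
    ((∑ p ∈ Finset.univ.filter
        (fun p : Equiv.Perm (Fin n) × Equiv.Perm (Fin n) =>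
          IsFullCycle p.1 ∧ cycleCount p.2 = k ∧ Separates m p.2),
      exceedCount p.1 p.2 : ℕ) : ℤ) =
    ((n : ℤ) - k) * Nat.factorial (n - 1) * sepCount n m k -
      ∑ j ∈ Finset.Icc 1 n,
        ((m * Nat.choose (k + 2 * j - m) (2 * j) +
            Nat.choose (k + 2 * j - m) (2 * j + 1) : ℕ) : ℤ) *
          Nat.factorial (n - 1) * sepCount n m (k + 2 * j) := by
  have hF := FF_eq (n := n)
  have h1 : 2 * ((∑ p ∈ Finset.univ.filter
        (fun p : Equiv.Perm (Fin n) × Equiv.Perm (Fin n) =>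
          IsFullCycle p.1 ∧ cycleCount p.2 = k ∧ Separates m p.2),
      exceedCount p.1 p.2 : ℕ) : ℤ) =
      FF n * (n * (G (Fin n) (SS n m)).coeff k - (∑ a, Gf (Fin n) (SS n m) a).coeff k) := by
    push_cast
    rw [Finset.sum_filter, Fintype.sum_prod_type_right, Finset.mul_sum, finsetSum_coeff]
    simp only [Gf_coeff]
    rw [G_coeff, Finset.sum_comm, Finset.mul_sum, ← Finset.sum_sub_distrib, Finset.mul_sum]
    refine Finset.sum_congr rfl fun π _ => ?_
    by_cases h : cycleCount π = k ∧ sepP (SS n m) π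
    · have h' : cycleCount π = k ∧ Separates m π := ⟨h.1, (separates_iff π).2 h.2⟩
      have := exceed_sum π
      simp only [h, h', and_true, if_true, and_self]
      rw [mul_one, ← this]
      refine congrArg (fun z : ℤ => 2 * z) (Finset.sum_congr rfl fun s _ => ?_)
      exact if_congr Iff.rfl rfl rfl
    · have h' : ¬ (cycleCount π = k ∧ Separates m π) := fun h' =>
        h ⟨h'.1, (separates_iff π).1 h'.2⟩
      simp [h, h']
  rw [Gf_sum hm, G_SS hm, hF] at h1
  simp only [sepCount_eq, G_SS hm]
  simp only [coeff_X_pow_mul'] at h1 ⊢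
  by_cases hmk : m ≤ k
  · obtain ⟨d, rfl⟩ := Nat.exists_eq_add_of_le hmk
    have e1 : ∀ j, m + d + 2 * j - m = d + 2 * j := fun j => by omega
    have e2 : ∀ j, m ≤ m + d + 2 * j := fun j => by omega
    simp only [e1, e2, if_true, hmk, Nat.add_sub_cancel_left] at h1 ⊢
    rw [H_coeff] at h1
    have h3 : ∑ j ∈ Finset.Icc 1 n,
        ((m * Nat.choose (d + 2 * j) (2 * j) + Nat.choose (d + 2 * j) (2 * j + 1) : ℕ) : ℤ) *
          Nat.factorial (n - 1) * (P m n).coeff (d + 2 * j) =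
        Nat.factorial (n - 1) * ∑ j ∈ Finset.Icc 1 n,
        ((m * Nat.choose (d + 2 * j) (2 * j) + Nat.choose (d + 2 * j) (2 * j + 1) : ℕ) : ℤ) *
          (P m n).coeff (d + 2 * j) := by
      rw [Finset.mul_sum]
      exact Finset.sum_congr rfl fun j _ => by ring
    rw [h3]
    push_cast at h1 ⊢
    linarith
  · have h4 : ∀ j ∈ Finset.Icc 1 n, ((m * Nat.choose (k + 2 * j - m) (2 * j) +
            Nat.choose (k + 2 * j - m) (2 * j + 1) : ℕ) : ℤ) = 0 := by
      intro j hj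
      rw [Finset.mem_Icc] at hj
      rw [Nat.choose_eq_zero_of_lt (by omega), Nat.choose_eq_zero_of_lt (by omega)]
      simp
    have h5 := Finset.sum_eq_zero (s := Finset.Icc 1 n) (f := fun j =>
      ((m * Nat.choose (k + 2 * j - m) (2 * j) +
            Nat.choose (k + 2 * j - m) (2 * j + 1) : ℕ) : ℤ) *
          Nat.factorial (n - 1) *
          if m ≤ k + 2 * j then (P m n).coeff (k + 2 * j - m) else 0)
      (fun j hj => by simp only [h4 j hj, zero_mul])
    rw [h5]
    simp only [hmk, if_false] at h1 ⊢
    linarith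
end
end

section
/- Let n ≥ 1, 0 ≤ m ≤ n, and k ≥ 1. Then, as an identity of rational numbers, (n+1−k) · 2·(n−1)!·C_m(n+1, k) / ((n+m)(n+1−m)) = (n−1)!·C_m(n, k) + Σ_{j≥1} [ m·binom(k+2j−m, 2j) + binom(k+2j−m, 2j+1) ] · 2·(n−1)!·C_m(n+1, k+2j) / ((n+m)(n+1−m)). Equivalently, 2(n+1−k)·C_m(n+1, k) = (n+m)(n+1−m)·C_m(n, k) + 2·Σ_{j≥1} [ m·binom(k+2j−m, 2j) + binom(k+2j−m, 2j+1) ]·C_m(n+1, k+2j). -/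
open Equiv Finset

noncomputable section

theorem sameCycle_map {α β : Type*} [Finite β] (σ : Equiv.Perm β) (τ : Equiv.Perm α) (f : β → α)
    (h : ∀ z, τ.SameCycle (f z) (f (σ z))) {z w : β} (hzw : σ.SameCycle z w) :
    τ.SameCycle (f z) (f w) := by
  obtain ⟨i, hi⟩ := hzw.exists_nat_pow_eq
  subst hi
  induction i with
  | zero => exact Equiv.Perm.SameCycle.refl _ _
  | succ i ih =>
    rw [pow_succ', Equiv.Perm.mul_apply]
    exact (ih ⟨i, by simp⟩).trans (h _)

theorem cycleCount_eq_card {n : ℕ} (σ : Equiv.Perm (Fin n)) :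
    cycleCount σ = Nat.card (Quotient (Equiv.Perm.SameCycle.setoid σ)) := by
  classical
  let h : Fin n → Equiv.Perm (Fin n) ⊕ Fin n :=
    fun x => if σ x = x then Sum.inr x else Sum.inl (σ.cycleOf x)
  have hk : Equiv.Perm.SameCycle.setoid σ = Setoid.ker h := by
    ext x y
    change σ.SameCycle x y ↔ h x = h y
    by_cases hx : σ x = x <;> by_cases hy : σ y = y
    · simp only [h, hx, hy, if_true, Sum.inr.injEq]
      constructor
      · intro hxy; exact hxy.eq_of_left hx
      · rintro rfl; exact Equiv.Perm.SameCycle.refl _ _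
    · simp only [h, hx, hy, if_true, if_false, reduceCtorEq, iff_false]
      intro hxy
      exact hy (by have := hxy.eq_of_left hx; rwa [← this])
    · simp only [h, hx, hy, if_true, if_false, reduceCtorEq, iff_false]
      intro hxy
      exact hx (by have := hxy.eq_of_right hy; rwa [this])
    · simp only [h, hx, hy, if_false, Sum.inl.injEq]
      exact Equiv.Perm.sameCycle_iff_cycleOf_eq_of_mem_support
        (by simpa using hx) (by simpa using hy)
  rw [hk, Nat.card_congr (Setoid.quotientKerEquivRange h)]
  have himg : Set.range h = ((σ.cycleFactorsFinset.disjSum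
      (Finset.univ.filter fun x => σ x = x) : Finset _) : Set _) := by
    ext z
    rcases z with c | x
    · simp only [Set.mem_range, Finset.mem_coe, Finset.inl_mem_disjSum]
      constructor
      · rintro ⟨x, hx⟩
        by_cases hxx : σ x = x
        · simp [h, hxx] at hx
        · simp only [h, hxx, if_false, Sum.inl.injEq] at hx
          rw [← hx, Equiv.Perm.cycleOf_mem_cycleFactorsFinset_iff]
          simpa using hxx
      · intro hc
        have hcyc := (Equiv.Perm.mem_cycleFactorsFinset_iff.mp hc).1
        obtain ⟨a, ha⟩ := hcyc.nonempty_support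
        refine ⟨a, ?_⟩
        have hca := Equiv.Perm.cycle_is_cycleOf ha hc
        have hs := Equiv.Perm.mem_cycleFactorsFinset_support_le hc ha
        have hne : σ a ≠ a := by simpa using hs
        simp [h, hne, ← hca]
    · simp only [Set.mem_range, Finset.mem_coe, Finset.inr_mem_disjSum, Finset.mem_filter,
        Finset.mem_univ, true_and]
      constructor
      · rintro ⟨y, hy⟩
        by_cases hyy : σ y = y
        · simp only [h, hyy, if_true, Sum.inr.injEq] at hy
          rwa [← hy]
        · simp [h, hyy] at hy
      · intro hx
        exact ⟨x, by simp [h, hx]⟩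
  rw [himg, Nat.card_coe_set_eq, Set.ncard_coe_finset, Finset.card_disjSum]
  simp [cycleCount, Equiv.Perm.cycleType_def]

/-- Inserting a new last element into a permutation. -/
def insEquiv (N : ℕ) : Option (Fin N) × Equiv.Perm (Fin N) ≃ Equiv.Perm (Fin (N + 1)) :=
  Equiv.Perm.decomposeOption.symm.trans (Equiv.permCongr finSuccEquivLast.symm)

theorem ins_none_last (N : ℕ) (τ : Equiv.Perm (Fin N)) :
    insEquiv N (none, τ) (Fin.last N) = Fin.last N := by
  simp [insEquiv, Equiv.permCongr_apply]

theorem ins_none_castSucc (N : ℕ) (τ : Equiv.Perm (Fin N)) (x : Fin N) :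
    insEquiv N (none, τ) x.castSucc = (τ x).castSucc := by
  simp [insEquiv, Equiv.permCongr_apply]

theorem ins_some_last (N : ℕ) (a : Fin N) (τ : Equiv.Perm (Fin N)) :
    insEquiv N (some a, τ) (Fin.last N) = a.castSucc := by
  simp [insEquiv, Equiv.permCongr_apply]

theorem ins_some_castSucc (N : ℕ) (a : Fin N) (τ : Equiv.Perm (Fin N)) (x : Fin N) :
    insEquiv N (some a, τ) x.castSucc = if τ x = a then Fin.last N else (τ x).castSucc := by
  split_ifs with h
  · simp [insEquiv, Equiv.permCongr_apply, h]
  · simp [insEquiv, Equiv.permCongr_apply, Equiv.swap_apply_of_ne_of_ne, h]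

theorem ins_sameCycle (N : ℕ) (o : Option (Fin N)) (τ : Equiv.Perm (Fin N)) (x y : Fin N) :
    (insEquiv N (o, τ)).SameCycle x.castSucc y.castSucc ↔ τ.SameCycle x y := by
  constructor
  · intro h
    let f : Fin (N + 1) → Fin N := Fin.lastCases (o.getD x) (fun i => i)
    have := sameCycle_map (insEquiv N (o, τ)) τ f ?_ h
    · simpa [f] using this
    · intro z
      induction z using Fin.lastCases with
      | last =>
        cases o with
        | none => rw [ins_none_last]
        | some a => rw [ins_some_last]; simp [f, Equiv.Perm.SameCycle.refl]
      | cast i =>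
        cases o with
        | none => rw [ins_none_castSucc]; simp [f, Equiv.Perm.SameCycle.refl]
        | some a =>
          rw [ins_some_castSucc]
          split_ifs with h
          · simp [f, ← h, Equiv.Perm.SameCycle.refl]
          · simp [f, Equiv.Perm.SameCycle.refl]
  · intro h
    refine sameCycle_map τ (insEquiv N (o, τ)) Fin.castSucc ?_ h
    intro z
    have h1 : (insEquiv N (o, τ)).SameCycle z.castSucc (insEquiv N (o, τ) z.castSucc) := ⟨1, by simp⟩
    cases o with
    | none => rwa [ins_none_castSucc] at h1
    | some a =>
      rw [ins_some_castSucc] at h1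
      split_ifs at h1 with h
      · have h2 : (insEquiv N (some a, τ)).SameCycle (Fin.last N)
          (insEquiv N (some a, τ) (Fin.last N)) := ⟨1, by simp⟩
        rw [ins_some_last] at h2
        rw [h]
        exact h1.trans h2
      · exact h1

theorem ins_separates (N m : ℕ) (hm : m ≤ N) (o : Option (Fin N)) (τ : Equiv.Perm (Fin N)) :
    Separates m (insEquiv N (o, τ)) ↔ Separates m τ := by
  constructor
  · intro h i j hi hj hij hs
    exact h i.castSucc j.castSucc (by simpa using hi) (by simpa using hj) (by simpa using hij)
      ((ins_sameCycle N o τ i j).2 hs)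
  · intro h i j hi hj hij hs
    have hi' : (i : ℕ) < N := by omega
    have hj' : (j : ℕ) < N := by omega
    refine h ⟨i, hi'⟩ ⟨j, hj'⟩ hi hj ?_ ((ins_sameCycle N o τ _ _).1 ?_)
    · simpa [Fin.ext_iff] using hij
    · exact hs

theorem ins_cycleCount_some (N : ℕ) (a : Fin N) (τ : Equiv.Perm (Fin N)) :
    cycleCount (insEquiv N (some a, τ)) = cycleCount τ := by
  rw [cycleCount_eq_card, cycleCount_eq_card]
  symm
  refine Nat.card_eq_of_bijective
    (Quotient.map' (s₁ := Equiv.Perm.SameCycle.setoid τ)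
      (s₂ := Equiv.Perm.SameCycle.setoid (insEquiv N (some a, τ))) Fin.castSucc
      (fun x y h => (ins_sameCycle N (some a) τ x y).2 h)) ⟨?_, ?_⟩
  · intro p q
    induction p using Quotient.inductionOn'
    induction q using Quotient.inductionOn'
    intro h
    exact Quotient.sound' ((ins_sameCycle N (some a) τ _ _).1 (Quotient.exact' h))
  · intro q
    induction q using Quotient.inductionOn' with
    | h z =>
      induction z using Fin.lastCases with
      | last =>
        refine ⟨Quotient.mk'' a, Quotient.sound' ?_⟩
        exact Equiv.Perm.SameCycle.symm ⟨1, by simp [ins_some_last]⟩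
      | cast i => exact ⟨Quotient.mk'' i, rfl⟩

theorem ins_cycleCount_none (N : ℕ) (τ : Equiv.Perm (Fin N)) :
    cycleCount (insEquiv N (none, τ)) = cycleCount τ + 1 := by
  rw [cycleCount_eq_card, cycleCount_eq_card, ← Finite.card_option]
  symm
  let g := Quotient.map' (s₁ := Equiv.Perm.SameCycle.setoid τ)
      (s₂ := Equiv.Perm.SameCycle.setoid (insEquiv N (none, τ))) Fin.castSucc
      (fun x y h => (ins_sameCycle N none τ x y).2 h)
  have hg : ∀ q, g q ≠ Quotient.mk'' (Fin.last N) := by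
    intro q
    induction q using Quotient.inductionOn' with
    | h x =>
      intro h
      have h1 : (insEquiv N (none, τ)).SameCycle x.castSucc (Fin.last N) := Quotient.exact' h
      have := h1.eq_of_right (ins_none_last N τ)
      exact absurd this (Fin.castSucc_lt_last x).ne
  refine Nat.card_eq_of_bijective
    (fun o : Option _ => o.elim (Quotient.mk'' (Fin.last N)) g) ⟨?_, ?_⟩
  · intro p q h
    cases p with
    | none =>
      cases q with
      | none => rfl
      | some q => exact absurd h.symm (hg q)
    | some p =>
      cases q with
      | none => exact absurd h (hg p)
      | some q =>
        induction p using Quotient.inductionOn'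
        induction q using Quotient.inductionOn'
        congr 1
        exact Quotient.sound' ((ins_sameCycle N none τ _ _).1 (Quotient.exact' h))
  · intro q
    induction q using Quotient.inductionOn' with
    | h z =>
      induction z using Fin.lastCases with
      | last => exact ⟨none, rfl⟩
      | cast i => exact ⟨some (Quotient.mk'' i), rfl⟩

open Classical in
/-- Generating polynomial of the separating permutations. -/
def sepPoly (N m : ℕ) : Polynomial ℤ :=
  ∑ σ : Equiv.Perm (Fin N), if Separates m σ then Polynomial.X ^ cycleCount σ else 0

theorem sepPoly_coeff (N m k : ℕ) : (sepPoly N m).coeff k = sepCount N m k := by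
  classical
  rw [sepPoly, Polynomial.finsetSum_coeff, sepCount, Nat.card_eq_fintype_card,
    Fintype.card_subtype, Finset.card_filter]
  push_cast
  refine Finset.sum_congr rfl fun σ _ => ?_
  by_cases h : Separates m σ <;> simp [h, Polynomial.coeff_X_pow, eq_comm]

theorem sepPoly_succ (N m : ℕ) (hm : m ≤ N) :
    sepPoly (N + 1) m = sepPoly N m * (Polynomial.X + (N : Polynomial ℤ)) := by
  classical
  rw [sepPoly, ← (insEquiv N).sum_comp, Fintype.sum_prod_type, Fintype.sum_option]
  simp only [ins_separates N m hm, ins_cycleCount_some, ins_cycleCount_none]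
  rw [Finset.sum_const, mul_add, sepPoly, Finset.sum_mul]
  congr 1
  · refine Finset.sum_congr rfl fun σ _ => ?_
    split_ifs <;> ring
  · simp [mul_comm]

theorem sepPoly_self (m : ℕ) : sepPoly m m = Polynomial.X ^ m := by
  classical
  rw [sepPoly, Finset.sum_eq_single 1]
  · rw [if_pos]
    · simp [cycleCount]
    · intro i j _ _ hij h
      exact hij (by simpa using h)
  · intro σ _ hσ
    rw [if_neg]
    intro h
    apply hσ
    ext x
    by_contra hx
    refine h x (σ x) x.2 (σ x).2 (fun hh => hx ?_) ⟨1, by simp⟩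
    rw [← hh]; rfl
  · simp

/-- The product `(X+m)(X+m+1)⋯(X+m+d-1)`. -/
def risePoly (m d : ℕ) : Polynomial ℤ :=
  ∏ i ∈ Finset.range d, (Polynomial.X + ((m + i : ℕ) : Polynomial ℤ))

theorem sepPoly_eq (m d : ℕ) : sepPoly (m + d) m = risePoly m d * Polynomial.X ^ m := by
  induction d with
  | zero => simp [sepPoly_self, risePoly]
  | succ d ih =>
    rw [← add_assoc, sepPoly_succ _ _ (by omega), ih, risePoly, risePoly, Finset.prod_range_succ]
    ring

theorem sepCount_add (m d r : ℕ) :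
    (sepCount (m + d) m (m + r) : ℤ) = (risePoly m d).coeff r := by
  rw [← sepPoly_coeff, sepPoly_eq, add_comm m r, Polynomial.coeff_mul_X_pow]

theorem sepCount_lt (m d k : ℕ) (h : k < m) : sepCount (m + d) m k = 0 := by
  have : (sepCount (m + d) m k : ℤ) = 0 := by
    rw [← sepPoly_coeff, sepPoly_eq, Polynomial.coeff_mul_X_pow']
    simp [h]
  exact_mod_cast this

theorem risePoly_natDegree (m d : ℕ) : (risePoly m d).natDegree ≤ d := by
  refine (Polynomial.natDegree_prod_le _ _).trans ?_
  refine (Finset.sum_le_card_nsmul _ _ 1 fun i _ => ?_).trans (by simp)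
  exact (Polynomial.natDegree_X_add_C ((m + i : ℕ) : ℤ)).le

theorem risePoly_down (m d : ℕ) :
    Polynomial.taylor (-1) (risePoly m (d + 1)) =
      risePoly m d * (Polynomial.X + (m : Polynomial ℤ) - 1) := by
  induction d with
  | zero =>
    simp [risePoly, Polynomial.taylor_apply]
    ring
  | succ d ih =>
    rw [risePoly, Finset.prod_range_succ, ← risePoly, Polynomial.taylor_mul, ih, risePoly, risePoly,
      Finset.prod_range_succ]
    simp [Polynomial.taylor_apply]
    ring

theorem risePoly_up (m d : ℕ) :
    (Polynomial.X + (m : Polynomial ℤ)) * Polynomial.taylor 1 (risePoly m d) =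
      risePoly m d * (Polynomial.X + (m : Polynomial ℤ) + (d : Polynomial ℤ)) := by
  induction d with
  | zero =>
    simp [risePoly, Polynomial.taylor_apply]
  | succ d ih =>
    rw [risePoly, Finset.prod_range_succ, ← risePoly, Polynomial.taylor_mul, ← mul_assoc, ih]
    simp [Polynomial.taylor_apply]
    ring

theorem risePoly_identity (m d : ℕ) :
    2 * ((m : Polynomial ℤ) + (d : Polynomial ℤ) + 1) * risePoly m (d + 1) =
      (2 * (m : Polynomial ℤ) + (d : Polynomial ℤ)) * ((d : Polynomial ℤ) + 1) * risePoly m d +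
      ((m : Polynomial ℤ) * (Polynomial.taylor 1 (risePoly m (d + 1)) + Polynomial.taylor (-1) (risePoly m (d + 1))) +
      Polynomial.X *
        (Polynomial.taylor 1 (risePoly m (d + 1)) - Polynomial.taylor (-1) (risePoly m (d + 1)))) := by
  have h1 := risePoly_up m (d + 1)
  have h2 := risePoly_down m d
  have h3 : risePoly m (d + 1) = risePoly m d * (Polynomial.X + ((m + d : ℕ) : Polynomial ℤ)) := by
    rw [risePoly, Finset.prod_range_succ, ← risePoly]
  rw [h2]
  generalize Polynomial.taylor 1 (risePoly m (d + 1)) = U at *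
  rw [h3] at *
  push_cast at *
  linear_combination -h1

theorem taylor_coeff_sum_s11 (p : Polynomial ℤ) (t : ℤ) (r B : ℕ) (hB : p.natDegree < B) :
    (Polynomial.taylor t p).coeff r =
      ∑ i ∈ Finset.range B, ((i + r).choose r : ℤ) * p.coeff (i + r) * t ^ i := by
  rw [Polynomial.taylor_coeff, Polynomial.eval_eq_sum_range' (n := B)]
  · simp [Polynomial.hasseDeriv_coeff]
  · exact lt_of_le_of_lt (Polynomial.natDegree_hasseDeriv_le _ _) (by omega)

theorem sum_range_two_mul (g : ℕ → ℤ) (B : ℕ) :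
    ∑ i ∈ Finset.range (2 * B), g i = ∑ j ∈ Finset.range B, (g (2 * j) + g (2 * j + 1)) := by
  induction B with
  | zero => simp
  | succ B ih =>
    rw [mul_add, mul_one, Finset.sum_range_succ, Finset.sum_range_succ, ih, Finset.sum_range_succ]
    ring

theorem even_part (p : Polynomial ℤ) (r B : ℕ) (hB : p.natDegree < 2 * B) :
    (Polynomial.taylor 1 p + Polynomial.taylor (-1) p).coeff r =
      2 * ∑ j ∈ Finset.range B, ((r + 2 * j).choose (2 * j) : ℤ) * p.coeff (r + 2 * j) := by
  rw [Polynomial.coeff_add, taylor_coeff_sum_s11 p _ r _ hB, taylor_coeff_sum_s11 p _ r _ hB,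
    sum_range_two_mul, sum_range_two_mul, ← Finset.sum_add_distrib, Finset.mul_sum]
  refine Finset.sum_congr rfl fun j _ => ?_
  have : (r + 2 * j).choose (2 * j) = (2 * j + r).choose r := by
    rw [add_comm, Nat.choose_symm_add]
  rw [this, add_comm r]
  simp [pow_succ, pow_mul]
  ring

theorem odd_part (p : Polynomial ℤ) (r B : ℕ) (hB : p.natDegree < 2 * B) :
    (Polynomial.X * (Polynomial.taylor 1 p - Polynomial.taylor (-1) p)).coeff r =
      2 * ∑ j ∈ Finset.range B, ((r + 2 * j).choose (2 * j + 1) : ℤ) * p.coeff (r + 2 * j) := by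
  cases r with
  | zero =>
    rw [Polynomial.coeff_X_mul_zero, Finset.sum_eq_zero, mul_zero]
    intro j _
    simp [Nat.choose_eq_zero_of_lt]
  | succ r =>
    rw [Polynomial.coeff_X_mul, Polynomial.coeff_sub, taylor_coeff_sum_s11 p _ r _ hB,
      taylor_coeff_sum_s11 p _ r _ hB,
      sum_range_two_mul, sum_range_two_mul, ← Finset.sum_sub_distrib, Finset.mul_sum]
    refine Finset.sum_congr rfl fun j _ => ?_
    have h1 : r + 1 + 2 * j = 2 * j + 1 + r := by ring
    have : (2 * j + 1 + r).choose (2 * j + 1) = (2 * j + 1 + r).choose r := by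
      rw [Nat.choose_symm_add]
    rw [h1, this]
    simp [pow_succ, pow_mul]
    ring

theorem rise_coeff_identity (m d r : ℕ) (hr : r ≤ d + 1) :
    2 * ((d : ℤ) + 1 - r) * (risePoly m (d + 1)).coeff r =
      (2 * m + d) * (d + 1) * (risePoly m d).coeff r +
      2 * ∑ j ∈ Finset.Icc 1 (m + d + 1),
        ((m : ℤ) * ((r + 2 * j).choose (2 * j) : ℤ) + ((r + 2 * j).choose (2 * j + 1) : ℤ)) *
          (risePoly m (d + 1)).coeff (r + 2 * j) := by
  have h := congrArg (fun p => Polynomial.coeff p r) (risePoly_identity m d)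
  have hB : (risePoly m (d + 1)).natDegree < 2 * (m + d + 2) :=
    lt_of_le_of_lt (risePoly_natDegree _ _) (by omega)
  have c1 : (2 * ((m : Polynomial ℤ) + (d : Polynomial ℤ) + 1)) = Polynomial.C (2 * ((m : ℤ) + d + 1)) := by simp
  have c2 : (2 * (m : Polynomial ℤ) + (d : Polynomial ℤ)) * ((d : Polynomial ℤ) + 1) =
    Polynomial.C ((2 * (m : ℤ) + d) * (d + 1)) := by simp
  have c3 : (m : Polynomial ℤ) = Polynomial.C (m : ℤ) := by simp
  rw [c1, c2, c3] at h
  beta_reduce at h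
  rw [Polynomial.coeff_C_mul, Polynomial.coeff_add, Polynomial.coeff_C_mul, Polynomial.coeff_add,
    Polynomial.coeff_C_mul] at h
  rw [even_part _ r _ hB, odd_part _ r _ hB] at h
  have hs : ∀ g : ℕ → ℤ, ∑ j ∈ Finset.range (m + d + 2), g j =
      g 0 + ∑ j ∈ Finset.Icc 1 (m + d + 1), g j := by
    intro g
    rw [Finset.range_eq_Ico, Finset.sum_eq_sum_Ico_succ_bot (by omega)]
    rfl
  rw [hs, hs] at h
  simp only [add_mul, Finset.sum_add_distrib, mul_assoc, ← Finset.mul_sum] at h ⊢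
  simp at h ⊢
  linear_combination h

/-- For `n ≥ 1`, `m ≤ n` and `k ≥ 1`:
`2(n+1-k) C_m(n+1, k) = (n+m)(n+1-m) C_m(n, k)
  + 2 Σ_{j ≥ 1} [ m binom(k+2j-m, 2j) + binom(k+2j-m, 2j+1) ] C_m(n+1, k+2j)`
(the sum over `j ≥ 1` is finite since `C_m(n+1, k+2j) = 0` once `k + 2j > n + 1`, so it
may be truncated at `j = n + 1`). -/
theorem sepCount_recurrence (n m k : ℕ) (hn : 1 ≤ n) (hm : m ≤ n) (hk : 1 ≤ k) :
    2 * (n + 1 - k) * sepCount (n + 1) m k =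
    (n + m) * (n + 1 - m) * sepCount n m k +
      2 * ∑ j ∈ Finset.Icc 1 (n + 1),
        (m * Nat.choose (k + 2 * j - m) (2 * j) +
          Nat.choose (k + 2 * j - m) (2 * j + 1)) * sepCount (n + 1) m (k + 2 * j) := by
  obtain ⟨d, rfl⟩ := Nat.exists_eq_add_of_le hm
  have e1 : m + d + 1 - m = d + 1 := by omega
  rw [e1]
  rcases lt_or_ge k m with hkm | hkm
  · rw [add_assoc m d 1, sepCount_lt _ _ _ hkm, sepCount_lt _ _ _ hkm, Finset.sum_eq_zero]
    · simp
    · intro j hj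
      have hj1 := (Finset.mem_Icc.1 hj).1
      rw [Nat.choose_eq_zero_of_lt (by omega), Nat.choose_eq_zero_of_lt (by omega)]
      simp
  obtain ⟨r, rfl⟩ := Nat.exists_eq_add_of_le hkm
  have e2 : m + d + 1 - (m + r) = d + 1 - r := by omega
  have e3 : ∀ j, m + r + 2 * j - m = r + 2 * j := by intro j; omega
  simp only [e2, e3]
  simp only [add_assoc m d 1, add_assoc m r]
  have hdeg : ∀ e s, e < s → (risePoly m e).coeff s = 0 := fun e s hs =>
    Polynomial.coeff_eq_zero_of_natDegree_lt (lt_of_le_of_lt (risePoly_natDegree _ _) hs)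
  zify
  simp only [sepCount_add]
  rcases le_or_gt r (d + 1) with hr | hr
  · have := rise_coeff_identity m d r hr
    push_cast [Nat.cast_sub hr]
    rw [this, ← add_assoc m d 1]
    ring
  · rw [hdeg _ _ hr, hdeg _ _ (by omega : d < r), Finset.sum_eq_zero]
    · simp
    · intro j _
      rw [hdeg _ _ (by omega : d + 1 < r + 2 * j), mul_zero]
end
end
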